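/- arXiv:2302.05666 — 7 statements merged into one kernel-verified Lean document; each statement's English description precedes it below -/
import Mathlib

section
/- The function ΔJML1 is a metric on the unit hypercube [0,1]^p: for all x, y, z ∈ [0,1]^p one has (i) ΔJML1(x,x) = 0, (ii) if x ≠ y then ΔJML1(x,y) > 0, (iii) ΔJML1(x,y) = ΔJML1(y,x), and (iv) ΔJML1(x,z) ≤ ΔJML1(x,y) + ΔJML1(y,z). -/
open Finset

/-- L¹ norm of a vector. -/
noncomputable def l1 {p : ℕ} (x : Fin p → ℝ) : ℝ := ∑ i, |x i|

/-- The first Jaccard metric loss, with the convention that division by zero yields 0. -/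
noncomputable def JML1 {p : ℕ} (x y : Fin p → ℝ) : ℝ :=
  2 * l1 (x - y) / (l1 x + l1 y + l1 (x - y))

theorem l1_nonneg {p : ℕ} (x : Fin p → ℝ) : 0 ≤ l1 x :=
  Finset.sum_nonneg fun _ _ => abs_nonneg _

theorem l1_pos {p : ℕ} {x : Fin p → ℝ} (hx : x ≠ 0) : 0 < l1 x := by
  obtain ⟨i, hi⟩ := Function.ne_iff.mp hx
  exact Finset.sum_pos' (fun _ _ => abs_nonneg _) ⟨i, Finset.mem_univ i, abs_pos.mpr hi⟩

theorem l1_add_le {p : ℕ} (x y : Fin p → ℝ) : l1 (x + y) ≤ l1 x + l1 y := by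
  unfold l1
  rw [← Finset.sum_add_distrib]
  exact Finset.sum_le_sum fun i _ => abs_add_le (x i) (y i)

theorem l1_sub_comm {p : ℕ} (x y : Fin p → ℝ) : l1 (x - y) = l1 (y - x) :=
  Finset.sum_congr rfl fun i _ => abs_sub_comm (x i) (y i)

theorem l1_sub_le {p : ℕ} (x y z : Fin p → ℝ) : l1 (x - z) ≤ l1 (x - y) + l1 (y - z) := by
  simpa using l1_add_le (x - y) (y - z)

theorem l1_le_add_l1_sub {p : ℕ} (x y : Fin p → ℝ) : l1 x ≤ l1 y + l1 (x - y) := by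
  simpa using l1_add_le y (x - y)

theorem two_mul_div_le_two_mul_div {d s t : ℝ} (hd : 0 ≤ d) (hs : d ≤ s) (hst : s ≤ t) :
    2 * d / t ≤ 2 * d / s := by
  rcases hd.eq_or_lt with rfl | hd
  · simp
  · exact div_le_div_of_nonneg_left (by positivity) (hd.trans_le hs) hst

theorem two_mul_div_add_le {s d e : ℝ} (hs : 0 ≤ s) (hd : 0 ≤ d) (hde : d ≤ e) :
    2 * d / (s + d) ≤ 2 * e / (s + e) := by
  rcases hd.eq_or_lt with rfl | hd
  · simp only [mul_zero, zero_div]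
    positivity
  · rw [div_le_div_iff₀ (by linarith) (by linarith)]
    nlinarith [mul_le_mul_of_nonneg_left hde hs]

theorem JML1_comm {p : ℕ} (x y : Fin p → ℝ) : JML1 x y = JML1 y x := by
  unfold JML1
  rw [l1_sub_comm x y, add_comm (l1 x)]

theorem JML1_pos {p : ℕ} {x y : Fin p → ℝ} (hxy : x ≠ y) : 0 < JML1 x y := by
  have h := l1_pos (sub_ne_zero.mpr hxy)
  have hx := l1_nonneg x
  have hy := l1_nonneg y
  unfold JML1
  positivity

theorem JML1_triangle {p : ℕ} (x y z : Fin p → ℝ) : JML1 x z ≤ JML1 x y + JML1 y z := by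
  have hx := l1_nonneg x
  have hy := l1_nonneg y
  have hz := l1_nonneg z
  have hxy := l1_nonneg (x - y)
  have hyz := l1_nonneg (y - z)
  have hyx := l1_le_add_l1_sub y x
  rw [l1_sub_comm y x] at hyx
  have hyz' := l1_le_add_l1_sub y z
  unfold JML1
  calc 2 * l1 (x - z) / (l1 x + l1 z + l1 (x - z))
      ≤ 2 * (l1 (x - y) + l1 (y - z)) / (l1 x + l1 z + (l1 (x - y) + l1 (y - z))) :=
        two_mul_div_add_le (by positivity) (l1_nonneg _) (l1_sub_le x y z)
    _ = 2 * l1 (x - y) / (l1 x + l1 z + (l1 (x - y) + l1 (y - z))) +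
        2 * l1 (y - z) / (l1 x + l1 z + (l1 (x - y) + l1 (y - z))) := by
        rw [mul_add, add_div]
    _ ≤ _ := add_le_add
        (two_mul_div_le_two_mul_div hxy (by linarith) (by linarith))
        (two_mul_div_le_two_mul_div hyz (by linarith) (by linarith))

theorem jml1_is_metric (p : ℕ) (hp : 1 ≤ p) (x y z : Fin p → ℝ)
    (hx : ∀ i, x i ∈ Set.Icc (0 : ℝ) 1)
    (hy : ∀ i, y i ∈ Set.Icc (0 : ℝ) 1)
    (hz : ∀ i, z i ∈ Set.Icc (0 : ℝ) 1) :
    JML1 x x = 0 ∧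
    (x ≠ y → 0 < JML1 x y) ∧
    JML1 x y = JML1 y x ∧
    JML1 x z ≤ JML1 x y + JML1 y z := by
  exact ⟨by simp [JML1, l1], JML1_pos, JML1_comm x y, JML1_triangle x y z⟩
end

section
/- The function ΔJML2 is a metric on the unit hypercube [0,1]^p: for all x, y, z ∈ [0,1]^p one has (i) ΔJML2(x,x) = 0, (ii) if x ≠ y then ΔJML2(x,y) > 0, (iii) ΔJML2(x,y) = ΔJML2(y,x), and (iv) ΔJML2(x,z) ≤ ΔJML2(x,y) + ΔJML2(y,z). -/
open Finset

/-- Inner product of two vectors. -/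
noncomputable def ip {p : ℕ} (x y : Fin p → ℝ) : ℝ := ∑ i, x i * y i

/-- The second Jaccard metric loss, with the convention that division by zero yields 0. -/
noncomputable def JML2 {p : ℕ} (x y : Fin p → ℝ) : ℝ :=
  l1 (x - y) / (ip x y + l1 (x - y))

theorem ip_comm {p : ℕ} (x y : Fin p → ℝ) : ip x y = ip y x :=
  sum_congr rfl fun i _ => mul_comm (x i) (y i)

theorem ip_nonneg {p : ℕ} {x y : Fin p → ℝ} (hx : ∀ i, 0 ≤ x i) (hy : ∀ i, 0 ≤ y i) :
    0 ≤ ip x y :=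
  sum_nonneg fun i _ => mul_nonneg (hx i) (hy i)

theorem ip_le_ip_add_l1_sub {p : ℕ} {x : Fin p → ℝ} (y z : Fin p → ℝ)
    (hx : ∀ i, x i ∈ Set.Icc (0 : ℝ) 1) : ip x y ≤ ip x z + l1 (y - z) := by
  simp only [ip, l1, ← sum_add_distrib]
  refine sum_le_sum fun i _ => ?_
  have h : x i * (y i - z i) ≤ |y i - z i| :=
    (mul_le_mul_of_nonneg_left (le_abs_self _) (hx i).1).trans
      (mul_le_of_le_one_left (abs_nonneg _) (hx i).2)
  rw [Pi.sub_apply]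
  linarith

theorem JML2_comm {p : ℕ} (x y : Fin p → ℝ) : JML2 x y = JML2 y x := by
  rw [JML2, JML2, ip_comm, l1_sub_comm]

theorem div_le_div_add_self {a A D : ℝ} (ha : 0 ≤ a) (hA : 0 ≤ A) (h : A + a ≤ D) :
    a / D ≤ a / (A + a) := by
  rcases ha.eq_or_lt with rfl | ha
  · simp
  · exact div_le_div_of_nonneg_left ha.le (by positivity) h

theorem div_add_self_le_div_add_self {C c d : ℝ} (hC : 0 ≤ C) (hc : 0 ≤ c) (h : c ≤ d) :
    c / (C + c) ≤ d / (C + d) := by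
  rcases hc.eq_or_lt with rfl | hc
  · rw [zero_div]
    positivity
  · rw [div_le_div_iff₀ (by positivity) (by linarith)]
    nlinarith [mul_le_mul_of_nonneg_left h hC]

theorem JML2_triangle {p : ℕ} {x y z : Fin p → ℝ}
    (hx : ∀ i, x i ∈ Set.Icc (0 : ℝ) 1) (hy : ∀ i, 0 ≤ y i)
    (hz : ∀ i, z i ∈ Set.Icc (0 : ℝ) 1) : JML2 x z ≤ JML2 x y + JML2 y z := by
  have hxy := ip_le_ip_add_l1_sub y z hx
  have hzy := ip_le_ip_add_l1_sub y x hz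
  rw [ip_comm z y, ip_comm z x, l1_sub_comm y x] at hzy
  calc JML2 x z
      ≤ (l1 (x - y) + l1 (y - z)) / (ip x z + (l1 (x - y) + l1 (y - z))) :=
        div_add_self_le_div_add_self (ip_nonneg (fun i => (hx i).1) fun i => (hz i).1)
          (l1_nonneg _) (l1_sub_le x y z)
    _ ≤ JML2 x y + JML2 y z := by
        rw [add_div]
        exact add_le_add
          (div_le_div_add_self (l1_nonneg _) (ip_nonneg (fun i => (hx i).1) hy) (by linarith))
          (div_le_div_add_self (l1_nonneg _) (ip_nonneg hy fun i => (hz i).1) (by linarith))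

theorem jml2_is_metric (p : ℕ) (hp : 1 ≤ p) (x y z : Fin p → ℝ)
    (hx : ∀ i, x i ∈ Set.Icc (0 : ℝ) 1)
    (hy : ∀ i, y i ∈ Set.Icc (0 : ℝ) 1)
    (hz : ∀ i, z i ∈ Set.Icc (0 : ℝ) 1) :
    JML2 x x = 0 ∧
    (x ≠ y → 0 < JML2 x y) ∧
    JML2 x y = JML2 y x ∧
    JML2 x z ≤ JML2 x y + JML2 y z := by
  refine ⟨by simp [JML2, l1], fun hne => ?_, JML2_comm x y,
    JML2_triangle hx (fun i => (hy i).1) hz⟩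
  have hl := l1_pos (sub_ne_zero.mpr hne)
  have hip := ip_nonneg (fun i => (hx i).1) fun i => (hy i).1
  exact div_pos hl (by positivity)
end

section
/- For every x ∈ [0,1]^p and every hard label y ∈ {0,1}^p (i.e. every coordinate of y is 0 or 1), with x and y not both the zero vector, the three losses coincide: ΔJML1(x,y) = ΔJML2(x,y) = ΔSJL,L1(x,y), and their common value equals 1 − (Σ_{i : yᵢ=1} xᵢ) / (Σ_{i : yᵢ=0} xᵢ + #{i : yᵢ = 1}). By the symmetry of all three losses, the same holds when x is the hard label and y ∈ [0,1]^p. -/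
open Finset

/-- The soft Jaccard loss with L¹ norm. -/
noncomputable def SJL1 {p : ℕ} (x y : Fin p → ℝ) : ℝ :=
  1 - ip x y / (l1 x + l1 y - ip x y)

theorem SJL1_comm {p : ℕ} (x y : Fin p → ℝ) : SJL1 x y = SJL1 y x := by
  rw [SJL1, SJL1, ip_comm, add_comm (l1 x)]

theorem l1_eq_zero_iff {p : ℕ} {x : Fin p → ℝ} : l1 x = 0 ↔ x = 0 := by
  rw [l1, Finset.sum_eq_zero_iff_of_nonneg fun i _ => abs_nonneg (x i)]
  simp [funext_iff]

theorem l1_sub_of_hard {p : ℕ} {x y : Fin p → ℝ} (hx : ∀ i, x i ∈ Set.Icc (0 : ℝ) 1)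
    (hy : ∀ i, y i = 0 ∨ y i = 1) : l1 (x - y) = l1 x + l1 y - 2 * ip x y := by
  simp only [l1, ip, Finset.mul_sum, ← Finset.sum_add_distrib, ← Finset.sum_sub_distrib]
  refine Finset.sum_congr rfl fun i _ => ?_
  obtain ⟨h0, h1⟩ := hx i
  rcases hy i with h | h
  · simp [h]
  · rw [Pi.sub_apply, h, abs_of_nonneg h0, abs_of_nonpos (sub_nonpos.2 h1), abs_one]
    ring

theorem ip_of_hard {p : ℕ} {x y : Fin p → ℝ} (hy : ∀ i, y i = 0 ∨ y i = 1) :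
    ip x y = ∑ i, if y i = 1 then x i else 0 :=
  Finset.sum_congr rfl fun i _ => by rcases hy i with h | h <;> simp [h]

theorem l1_add_l1_sub_ip_of_hard {p : ℕ} {x y : Fin p → ℝ} (hx : ∀ i, 0 ≤ x i)
    (hy : ∀ i, y i = 0 ∨ y i = 1) :
    l1 x + l1 y - ip x y =
      (∑ i, if y i = 0 then x i else 0) + ∑ i, if y i = 1 then (1 : ℝ) else 0 := by
  simp only [l1, ip, ← Finset.sum_add_distrib, ← Finset.sum_sub_distrib]
  refine Finset.sum_congr rfl fun i _ => ?_
  rcases hy i with h | h <;> simp [h, abs_of_nonneg (hx i)]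

theorem l1_add_l1_sub_ip_pos {p : ℕ} {x y : Fin p → ℝ} (hx : ∀ i, x i ∈ Set.Icc (0 : ℝ) 1)
    (hy : ∀ i, y i = 0 ∨ y i = 1) (h0 : ¬(x = 0 ∧ y = 0)) : 0 < l1 x + l1 y - ip x y := by
  have hd := l1_sub_of_hard hx hy
  have hdn := l1_nonneg (x - y)
  have hxn := l1_nonneg x
  have hyn := l1_nonneg y
  by_contra! hle
  exact h0 ⟨l1_eq_zero_iff.1 (by linarith), l1_eq_zero_iff.1 (by linarith)⟩

theorem losses_coincide_on_hard_labels (p : ℕ) (hp : 1 ≤ p) (x y : Fin p → ℝ)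
    (hx : ∀ i, x i ∈ Set.Icc (0 : ℝ) 1)
    (hy : ∀ i, y i = 0 ∨ y i = 1)
    (h0 : ¬(x = 0 ∧ y = 0)) :
    (JML1 x y = JML2 x y ∧ JML2 x y = SJL1 x y ∧
      SJL1 x y = 1 - (∑ i, if y i = 1 then x i else 0) /
        ((∑ i, if y i = 0 then x i else 0) + ∑ i, if y i = 1 then (1 : ℝ) else 0)) ∧
    (JML1 y x = JML2 y x ∧ JML2 y x = SJL1 y x ∧
      SJL1 y x = 1 - (∑ i, if y i = 1 then x i else 0) /
        ((∑ i, if y i = 0 then x i else 0) + ∑ i, if y i = 1 then (1 : ℝ) else 0)) := by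
  have hd := l1_sub_of_hard hx hy
  have hpos := l1_add_l1_sub_ip_pos hx hy h0
  have h12 : JML1 x y = JML2 x y := by
    rw [JML1, JML2, show l1 x + l1 y + l1 (x - y) = 2 * (ip x y + l1 (x - y)) by linarith,
      mul_div_mul_left _ _ two_ne_zero]
  have h2S : JML2 x y = SJL1 x y := by
    rw [JML2, SJL1, show ip x y + l1 (x - y) = l1 x + l1 y - ip x y by linarith,
      eq_sub_iff_add_eq, ← add_div, div_eq_one_iff_eq hpos.ne']
    linarith
  have hS : SJL1 x y = 1 - (∑ i, if y i = 1 then x i else 0) /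
      ((∑ i, if y i = 0 then x i else 0) + ∑ i, if y i = 1 then (1 : ℝ) else 0) := by
    rw [SJL1, l1_add_l1_sub_ip_of_hard (fun i => (hx i).1) hy, ip_of_hard hy]
  rw [JML1_comm y x, JML2_comm y x, SJL1_comm y x]
  exact ⟨⟨h12, h2S, hS⟩, h12, h2S, hS⟩
end

section
/- For all x, y ∈ [0,1]^p, ΔJML1(x,y) ≤ ΔJML2(x,y). -/
open Finset

lemma two_mul_ip_add_l1_sub_le {p : ℕ} {x y : Fin p → ℝ}
    (hx : ∀ i, x i ∈ Set.Icc (0 : ℝ) 1) (hy : ∀ i, y i ∈ Set.Icc (0 : ℝ) 1) :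
    2 * ip x y + l1 (x - y) ≤ l1 x + l1 y := by
  simp only [ip, l1, mul_sum, ← sum_add_distrib, Pi.sub_apply]
  refine sum_le_sum fun i _ => ?_
  obtain ⟨hx0, hx1⟩ := hx i
  obtain ⟨hy0, hy1⟩ := hy i
  rw [abs_of_nonneg hx0, abs_of_nonneg hy0]
  rcases abs_cases (x i - y i) with ⟨h, _⟩ | ⟨h, _⟩ <;> rw [h] <;> nlinarith

theorem jml1_le_jml2 (p : ℕ) (hp : 1 ≤ p) (x y : Fin p → ℝ)
    (hx : ∀ i, x i ∈ Set.Icc (0 : ℝ) 1)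
    (hy : ∀ i, y i ∈ Set.Icc (0 : ℝ) 1) :
    JML1 x y ≤ JML2 x y := by
  have hip : 0 ≤ ip x y := sum_nonneg fun i _ => mul_nonneg (hx i).1 (hy i).1
  have hd : 0 ≤ l1 (x - y) := sum_nonneg fun i _ => abs_nonneg _
  have key := two_mul_ip_add_l1_sub_le hx hy
  rcases hd.eq_or_lt with h | h
  · simp [JML1, JML2, ← h]
  · rw [JML1, JML2, div_le_div_iff₀ (by linarith) (by linarith)]
    nlinarith
end

section
/- For all x, y ∈ [0,1]^p, ‖x‖₁ + ‖y‖₁ ≥ ‖x−y‖₁ + 2⟨x,y⟩. Equivalently, (‖x‖₁ + ‖y‖₁)·‖x−y‖₁ − ‖x−y‖₁² − 2⟨x,y⟩·‖x−y‖₁ ≥ 0. -/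
open Finset

theorem key_inequality (p : ℕ) (hp : 1 ≤ p) (x y : Fin p → ℝ)
    (hx : ∀ i, x i ∈ Set.Icc (0 : ℝ) 1)
    (hy : ∀ i, y i ∈ Set.Icc (0 : ℝ) 1) :
    l1 (x - y) + 2 * ip x y ≤ l1 x + l1 y ∧
    0 ≤ (l1 x + l1 y) * l1 (x - y) - (l1 (x - y)) ^ 2 - 2 * ip x y * l1 (x - y) := by
  have key : l1 (x - y) + 2 * ip x y ≤ l1 x + l1 y := by
    unfold l1 ip
    rw [mul_sum, ← sum_add_distrib, ← sum_add_distrib]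
    refine sum_le_sum fun i _ => ?_
    obtain ⟨hx₀, hx₁⟩ := hx i
    obtain ⟨hy₀, hy₁⟩ := hy i
    rw [Pi.sub_apply, abs_of_nonneg hx₀, abs_of_nonneg hy₀]
    have h₁ : x i * y i ≤ x i := mul_le_of_le_one_right hx₀ hy₁
    have h₂ : x i * y i ≤ y i := mul_le_of_le_one_left hy₀ hx₁
    rcases abs_cases (x i - y i) with h | h <;> linarith
  have hnonneg : 0 ≤ l1 (x - y) := sum_nonneg fun i _ => abs_nonneg _
  refine ⟨key, ?_⟩
  linarith [mul_le_mul_of_nonneg_right key hnonneg]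
end

section
/- For every fixed y ∈ (0,1], the single-pixel soft Jaccard loss x ↦ 1 − x·y/(x + y − x·y) is strictly decreasing on [0,1]; in particular, it attains its minimum over [0,1] uniquely at x = 1, so for y < 1 it is not minimized at x = y. -/
theorem soft_jaccard_denom_pos {x y : ℝ} (hx : x ∈ Set.Icc (0 : ℝ) 1) (hy : 0 < y) :
    0 < x + y - x * y := by
  obtain ⟨h0, h1⟩ := hx
  rcases h0.eq_or_lt with rfl | h0
  · simpa using hy
  · nlinarith [mul_nonneg (sub_nonneg.2 h1) hy.le]

theorem strictAntiOn_soft_jaccard_loss {y : ℝ} (hy : 0 < y) :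
    StrictAntiOn (fun x : ℝ => 1 - x * y / (x + y - x * y)) (Set.Icc (0 : ℝ) 1) := by
  intro a ha b hb hab
  refine sub_lt_sub_left ?_ 1
  rw [div_lt_div_iff₀ (soft_jaccard_denom_pos ha hy) (soft_jaccard_denom_pos hb hy)]
  nlinarith [mul_pos (mul_pos hy hy) (sub_pos.2 hab)]

theorem single_pixel_sjl_strictly_decreasing (y : ℝ) (hy : y ∈ Set.Ioc (0 : ℝ) 1) :
    StrictAntiOn (fun x : ℝ => 1 - x * y / (x + y - x * y)) (Set.Icc (0 : ℝ) 1) ∧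
    (∀ x ∈ Set.Icc (0 : ℝ) 1, x ≠ 1 →
      1 - 1 * y / (1 + y - 1 * y) < 1 - x * y / (x + y - x * y)) ∧
    (y < 1 → 1 - 1 * y / (1 + y - 1 * y) < 1 - y * y / (y + y - y * y)) := by
  have anti := strictAntiOn_soft_jaccard_loss hy.1
  have one_mem : (1 : ℝ) ∈ Set.Icc (0 : ℝ) 1 := ⟨zero_le_one, le_rfl⟩
  exact ⟨anti, fun x hx hne => anti hx one_mem (lt_of_le_of_ne hx.2 hne),
    fun hlt => anti ⟨hy.1.le, hy.2⟩ one_mem hlt⟩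
end

section
/- Fix reals a > 0, b ≥ 0 and y ∈ [0,1]. Then the function f(x) = 1 − (x·y + b)/(x + y − x·y + a) is differentiable on [0,1] with derivative f'(x) = −(y² + (a+b)·y − b)/(x + y − x·y + a)², and f'(x) ≤ 0 for all x ∈ [0,1] if and only if y ≥ r₂, where r₂ = (−(a+b) + √((a+b)² + 4b))/2; for y < r₂ the derivative is strictly positive. -/
/-- The larger root of `t ^ 2 + p * t - q` is at most a nonnegative `t` exactly when the quadratic
is nonnegative at `t`. -/
theorem larger_root_le_iff {p q t : ℝ} (hp : 0 ≤ p) (ht : 0 ≤ t) :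
    (-p + Real.sqrt (p ^ 2 + 4 * q)) / 2 ≤ t ↔ 0 ≤ t ^ 2 + p * t - q := by
  have h : (-p + Real.sqrt (p ^ 2 + 4 * q)) / 2 ≤ t ↔
      Real.sqrt (p ^ 2 + 4 * q) ≤ 2 * t + p := by
    constructor <;> intro h <;> linarith
  rw [h, Real.sqrt_le_left (by positivity)]
  constructor <;> intro h <;> nlinarith

theorem sjl_derivative_sign (a b y : ℝ) (ha : 0 < a) (hb : 0 ≤ b)
    (hy : y ∈ Set.Icc (0 : ℝ) 1) :
    (∀ x ∈ Set.Icc (0 : ℝ) 1,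
      HasDerivAt (fun x : ℝ => 1 - (x * y + b) / (x + y - x * y + a))
        (-(y ^ 2 + (a + b) * y - b) / (x + y - x * y + a) ^ 2) x) ∧
    ((∀ x ∈ Set.Icc (0 : ℝ) 1,
        -(y ^ 2 + (a + b) * y - b) / (x + y - x * y + a) ^ 2 ≤ 0) ↔
      (-(a + b) + Real.sqrt ((a + b) ^ 2 + 4 * b)) / 2 ≤ y) ∧
    (y < (-(a + b) + Real.sqrt ((a + b) ^ 2 + 4 * b)) / 2 →
      ∀ x ∈ Set.Icc (0 : ℝ) 1,
        0 < -(y ^ 2 + (a + b) * y - b) / (x + y - x * y + a) ^ 2) := by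
  have hroot := larger_root_le_iff (q := b) (add_nonneg ha.le hb) hy.1
  have hden : ∀ x ∈ Set.Icc (0 : ℝ) 1, 0 < x + y - x * y + a := fun x hx => by
    have := mul_nonneg hx.1 (sub_nonneg.2 hy.2)
    linarith [hy.1]
  have hpos : y < (-(a + b) + Real.sqrt ((a + b) ^ 2 + 4 * b)) / 2 →
      ∀ x ∈ Set.Icc (0 : ℝ) 1,
        0 < -(y ^ 2 + (a + b) * y - b) / (x + y - x * y + a) ^ 2 := fun h x hx => by
    have hneg := lt_of_not_ge fun h' => h.not_ge (hroot.2 h')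
    exact div_pos (neg_pos.2 hneg) (pow_pos (hden x hx) 2)
  refine ⟨fun x hx => ?_, ⟨fun h => ?_, fun h x _ => ?_⟩, hpos⟩
  · have hxy : HasDerivAt (fun x : ℝ => x * y) y x := by
      simpa using (hasDerivAt_id x).mul_const y
    have hD : HasDerivAt (fun x : ℝ => x + y - x * y + a) (1 - y) x :=
      (((hasDerivAt_id x).add_const y).sub hxy).add_const a
    refine (((hxy.add_const b).div hD (hden x hx).ne').const_sub 1).congr_deriv ?_
    rw [← neg_div]
    congr 1
    ring
  · by_contra! hlt
    have h0 : (0 : ℝ) ∈ Set.Icc (0 : ℝ) 1 := ⟨le_rfl, zero_le_one⟩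
    exact (hpos hlt 0 h0).not_ge (h 0 h0)
  · exact div_nonpos_of_nonpos_of_nonneg (neg_nonpos.2 (hroot.1 h)) (sq_nonneg _)
end
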